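/- The center Z = HH^0(A) of A below top degree is concentrated in even degrees, one dimension in each even degree 2k with 0 ≤ 2k ≤ h−3: every non-top-degree central element of degree 2k is a scalar multiple of z_{2k} = ∑_{i=k+1}^n c_{i,2k}, and there are no nonzero central elements of odd degree below the top degree. -/

import Mathlib

/-!
STATEMENT 11. Let `A = Π_{T_n}` be the preprojective algebra of the quiver of type `T_n`
(0-based vertices `0, …, n-1`, arrows `a i : i → i+1`, reversed arrows, loop `b` at the
last vertex, preprojective relation `∑ [a,a*] = b²`), graded with arrows in degree 1;
`h = 2n+1`, the top degree of `A` is `h - 2 = 2n - 1`.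

Claim: the center `Z = HH^0(A)` below the top degree is concentrated in even degrees, one
dimension in each even degree `2k` with `0 ≤ 2k ≤ h-3`: every central element of degree
`2k < h-2` is a scalar multiple of `z_{2k} = ∑_{i=k+1}^{n} c_{i,2k}` (where `c_{i,2k}`
is a path of length `2k` beginning and ending at vertex `i`, e.g. `(a* a)ᵏ`), and there
are no nonzero central elements of odd degree below the top degree.
-/

inductive TGen (n : ℕ) : Type
  | e : Fin n → TGen n
  | a : Fin n → TGen n
  | astar : Fin n → TGen n
  | b : TGen n

namespace TPre

open FreeAlgebra

abbrev F (n : ℕ) := FreeAlgebra ℂ (TGen n)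

def g {n : ℕ} (x : TGen n) : F n := FreeAlgebra.ι ℂ x

/-- The defining relations of the preprojective algebra `Π_{T_n}`. -/
inductive TRel (n : ℕ) : F n → F n → Prop
  | idem (i j : Fin n) : TRel n (g (.e i) * g (.e j)) (if i = j then g (.e i) else 0)
  | sum_idem : TRel n (∑ i : Fin n, g (.e i)) 1
  | a_path (i : Fin n) (h : (i : ℕ) + 1 < n) :
      TRel n (g (.e ⟨(i : ℕ) + 1, h⟩) * g (.a i) * g (.e i)) (g (.a i))
  | a_junk (i : Fin n) (h : ¬ (i : ℕ) + 1 < n) : TRel n (g (.a i)) 0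
  | astar_path (i : Fin n) (h : (i : ℕ) + 1 < n) :
      TRel n (g (.e i) * g (.astar i) * g (.e ⟨(i : ℕ) + 1, h⟩)) (g (.astar i))
  | astar_junk (i : Fin n) (h : ¬ (i : ℕ) + 1 < n) : TRel n (g (.astar i)) 0
  | b_path (i : Fin n) (h : (i : ℕ) + 1 = n) :
      TRel n (g (.e i) * g .b * g (.e i)) (g .b)
  | preproj :
      TRel n (∑ i : Fin n, (g (.a i) * g (.astar i) - g (.astar i) * g (.a i)))
        (g .b * g .b)

/-- The preprojective algebra `A = Π_{T_n}` over `ℂ`. -/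
abbrev PiT (n : ℕ) := RingQuot (TRel n)

def gen {n : ℕ} (x : TGen n) : PiT n := RingQuot.mkAlgHom ℂ (TRel n) (g x)

/-- The weight of a generator: trivial paths have degree `0`, arrows degree `1`. -/
def wt {n : ℕ} : TGen n → ℕ
  | .e _ => 0
  | _ => 1

/-- The degree-`d` homogeneous component of `Π_{T_n}`. -/
def adeg (n d : ℕ) : Submodule ℂ (PiT n) :=
  Submodule.span ℂ {x | ∃ l : List (TGen n), (l.map wt).sum = d ∧ x = (l.map gen).prod}

/-- `c_{j,2k}`: a path of length `2k` starting and ending at vertex `j`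
(for `k = 0` the trivial path `e_j`, for `k ≥ 1` the path `(a_{j-1} a*_{j-1})ᵏ`,
which requires `j ≥ 1`). -/
def cpath (n : ℕ) (j : Fin n) (k : ℕ) : PiT n :=
  if k = 0 then gen (TGen.e j)
  else if h : 1 ≤ (j : ℕ) then
    (gen (TGen.a ⟨(j : ℕ) - 1, by omega⟩) * gen (TGen.astar ⟨(j : ℕ) - 1, by omega⟩)) ^ k
  else 0

/-- The degree-`2k` central element `z_{2k} = ∑_{j ≥ k} c_{j,2k}`
(in the paper's 1-based labels, `z_{2k} = ∑_{i=k+1}^{n} c_{i,2k}`). -/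
def zz (n k : ℕ) : PiT n :=
  ∑ j : Fin n, if k ≤ (j : ℕ) then cpath n j k else 0

end TPre

open TPre

namespace TPre

noncomputable section

def eps (n i : ℕ) : PiT n := if h : i < n then gen (.e ⟨i, h⟩) else 0
def al (n i : ℕ) : PiT n := if h : i + 1 < n then gen (.a ⟨i, by omega⟩) else 0
def be (n i : ℕ) : PiT n := if h : i + 1 < n then gen (.astar ⟨i, by omega⟩) else 0
def bb (n : ℕ) : PiT n := gen .b
def uu (n : ℕ) : PiT n := ∑ i ∈ Finset.range n, al n i * be n i

lemma rel_eq {n : ℕ} {x y : F n} (h : TRel n x y) :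
    RingQuot.mkAlgHom ℂ (TRel n) x = RingQuot.mkAlgHom ℂ (TRel n) y :=
  RingQuot.mkAlgHom_rel ℂ h

lemma gen_e {n : ℕ} (i : Fin n) : gen (.e i) = eps n i := by simp [eps]
lemma gen_a {n : ℕ} (i : Fin n) : gen (.a i) = al n i := by
  unfold al
  split_ifs with h
  · rfl
  · simpa [gen] using rel_eq (TRel.a_junk i h)
lemma gen_astar {n : ℕ} (i : Fin n) : gen (.astar i) = be n i := by
  unfold be
  split_ifs with h
  · rfl
  · simpa [gen] using rel_eq (TRel.astar_junk i h)

lemma eps_ge {n i : ℕ} (h : n ≤ i) : eps n i = 0 := by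
  simp [eps, h]
lemma al_ge {n i : ℕ} (h : n ≤ i + 1) : al n i = 0 := by
  simp [al, h]
lemma be_ge {n i : ℕ} (h : n ≤ i + 1) : be n i = 0 := by
  simp [be, h]

lemma eps_mul (n i j : ℕ) : eps n i * eps n j = if i = j then eps n i else 0 := by
  by_cases hi : i < n
  · by_cases hj : j < n
    · have := rel_eq (TRel.idem (⟨i, hi⟩ : Fin n) ⟨j, hj⟩)
      rw [map_mul] at this
      simp only [eps, hi, hj, dif_pos, gen]
      rw [this]
      simp only [Fin.mk.injEq]
      split_ifs <;> simp
    · have : i ≠ j := by omega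
      simp [eps, hj, this]
  · simp [eps, hi]

lemma eps_self (n i : ℕ) : eps n i * eps n i = eps n i := by simp [eps_mul]
lemma eps_ne {n i j : ℕ} (h : i ≠ j) : eps n i * eps n j = 0 := by simp [eps_mul, h]

lemma sum_eps (n : ℕ) : ∑ i ∈ Finset.range n, eps n i = 1 := by
  have := rel_eq (TRel.sum_idem (n := n))
  rw [Finset.sum_range]
  simpa [← gen_e, gen] using this

lemma al_both (n i : ℕ) : eps n (i+1) * al n i * eps n i = al n i := by
  by_cases h : i + 1 < n
  · have := rel_eq (TRel.a_path (⟨i, by omega⟩ : Fin n) h)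
    simpa [eps, al, h, gen, show i < n by omega] using this
  · simp [al, h]
lemma be_both (n i : ℕ) : eps n i * be n i * eps n (i+1) = be n i := by
  by_cases h : i + 1 < n
  · have := rel_eq (TRel.astar_path (⟨i, by omega⟩ : Fin n) h)
    simpa [eps, be, h, gen, show i < n by omega] using this
  · simp [be, h]
lemma bb_both {n : ℕ} (hn : 1 ≤ n) : eps n (n-1) * bb n * eps n (n-1) = bb n := by
  have := rel_eq (TRel.b_path (⟨n-1, by omega⟩ : Fin n) (by simp; omega))
  simpa [eps, bb, gen, show n - 1 < n by omega] using this

lemma eps_al (n i : ℕ) : eps n (i+1) * al n i = al n i := by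
  rw [← al_both, ← mul_assoc, ← mul_assoc, eps_self]
lemma al_eps (n i : ℕ) : al n i * eps n i = al n i := by
  rw [← al_both, mul_assoc, eps_self]
lemma eps_be (n i : ℕ) : eps n i * be n i = be n i := by
  rw [← be_both, ← mul_assoc, ← mul_assoc, eps_self]
lemma be_eps (n i : ℕ) : be n i * eps n (i+1) = be n i := by
  rw [← be_both, mul_assoc, eps_self]
lemma eps_bb {n : ℕ} (hn : 1 ≤ n) : eps n (n-1) * bb n = bb n := by
  rw [← bb_both hn, ← mul_assoc, ← mul_assoc, eps_self]
lemma bb_eps {n : ℕ} (hn : 1 ≤ n) : bb n * eps n (n-1) = bb n := by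
  rw [← bb_both hn, mul_assoc, eps_self]

lemma eps_al_ne {n i j : ℕ} (h : j ≠ i + 1) : eps n j * al n i = 0 := by
  rw [← eps_al, ← mul_assoc, eps_ne h, zero_mul]
lemma al_eps_ne {n i j : ℕ} (h : i ≠ j) : al n i * eps n j = 0 := by
  rw [← al_eps, mul_assoc, eps_ne h, mul_zero]
lemma eps_be_ne {n i j : ℕ} (h : j ≠ i) : eps n j * be n i = 0 := by
  rw [← eps_be, ← mul_assoc, eps_ne h, zero_mul]
lemma be_eps_ne {n i j : ℕ} (h : i + 1 ≠ j) : be n i * eps n j = 0 := by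
  rw [← be_eps, mul_assoc, eps_ne h, mul_zero]
lemma bb_eps_ne {n j : ℕ} (hn : 1 ≤ n) (h : j ≠ n - 1) : bb n * eps n j = 0 := by
  rw [← bb_eps hn, mul_assoc, eps_ne h.symm, mul_zero]

lemma preproj (n : ℕ) :
    uu n - ∑ i ∈ Finset.range n, be n i * al n i = bb n * bb n := by
  have := rel_eq (TRel.preproj (n := n))
  rw [uu, ← Finset.sum_sub_distrib, Finset.sum_range]
  simpa [← gen_a, ← gen_astar, gen, bb] using this

lemma uu_eps_succ {n i : ℕ} (_h : i + 1 < n) : uu n * eps n (i+1) = al n i * be n i := by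
  rw [uu, Finset.sum_mul, Finset.sum_eq_single i]
  · rw [mul_assoc, be_eps]
  · intro j _ hj
    rw [mul_assoc, be_eps_ne (by omega), mul_zero]
  · intro h; simp at h; omega
lemma eps_uu_succ {n i : ℕ} (_h : i + 1 < n) : eps n (i+1) * uu n = al n i * be n i := by
  rw [uu, Finset.mul_sum, Finset.sum_eq_single i]
  · rw [← mul_assoc, eps_al]
  · intro j _ hj
    rw [← mul_assoc, eps_al_ne (by omega), zero_mul]
  · intro h; simp at h; omega
lemma uu_eps_zero (n : ℕ) : uu n * eps n 0 = 0 := by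
  rw [uu, Finset.sum_mul]
  refine Finset.sum_eq_zero fun j _ => ?_
  rw [mul_assoc, be_eps_ne (by omega), mul_zero]
lemma eps_uu_zero (n : ℕ) : eps n 0 * uu n = 0 := by
  rw [uu, Finset.mul_sum]
  refine Finset.sum_eq_zero fun j _ => ?_
  rw [← mul_assoc, eps_al_ne (by omega), zero_mul]
lemma eps_uu (n i : ℕ) : eps n i * uu n = uu n * eps n i := by
  cases i with
  | zero => rw [uu_eps_zero, eps_uu_zero]
  | succ i =>
    by_cases h : i + 1 < n
    · rw [uu_eps_succ h, eps_uu_succ h]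
    · simp [eps_ge (not_lt.mp h)]

lemma sum_be_al_eps (n i : ℕ) :
    (∑ j ∈ Finset.range n, be n j * al n j) * eps n i = be n i * al n i := by
  rw [Finset.sum_mul]
  by_cases h : i < n
  · rw [Finset.sum_eq_single i]
    · rw [mul_assoc, al_eps]
    · intro j _ hj
      rw [mul_assoc, al_eps_ne hj, mul_zero]
    · intro h; simp at h; omega
  · simp [eps_ge (not_lt.mp h), al_ge (show n ≤ i + 1 by omega)]

lemma be_al {n i : ℕ} (h : i + 1 < n) : be n i * al n i = uu n * eps n i := by
  have := congrArg (· * eps n i) (preproj n)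
  simp only [sub_mul, sum_be_al_eps] at this
  rw [mul_assoc (bb n), bb_eps_ne (by omega) (by omega), mul_zero] at this
  exact (sub_eq_zero.mp this).symm
lemma bb_bb {n : ℕ} (hn : 1 ≤ n) : bb n * bb n = uu n * eps n (n-1) := by
  have := congrArg (· * eps n (n-1)) (preproj n)
  simp only [sub_mul, sum_be_al_eps] at this
  rw [mul_assoc (bb n), bb_eps hn, be_ge (by omega), zero_mul, sub_zero] at this
  exact this.symm
lemma al_be {n i : ℕ} (h : i + 1 < n) : al n i * be n i = uu n * eps n (i+1) :=
  (uu_eps_succ h).symm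

lemma uu_al (n i : ℕ) : al n i * uu n = uu n * al n i := by
  by_cases h : i + 1 < n
  · rw [← al_eps, mul_assoc, eps_uu, ← be_al h, al_eps, ← mul_assoc, al_be h, mul_assoc, eps_al]
  · simp [al_ge (not_lt.mp h)]
lemma uu_be (n i : ℕ) : be n i * uu n = uu n * be n i := by
  by_cases h : i + 1 < n
  · rw [← be_eps, mul_assoc, eps_uu, ← al_be h, be_eps, ← mul_assoc, be_al h, mul_assoc, eps_be]
  · simp [be_ge (not_lt.mp h)]
lemma uu_bb {n : ℕ} (hn : 1 ≤ n) : bb n * uu n = uu n * bb n := by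
  rw [← bb_eps hn, mul_assoc, eps_uu, ← bb_bb hn, bb_eps hn, ← mul_assoc, bb_bb hn, mul_assoc,
    eps_bb hn]

lemma comm_all {n : ℕ} (z : PiT n) (h : ∀ t : TGen n, gen t * z = z * gen t) (x : PiT n) :
    x * z = z * x := by
  obtain ⟨y, rfl⟩ := RingQuot.mkAlgHom_surjective ℂ (TRel n) x
  induction y using FreeAlgebra.induction with
  | grade0 r => rw [AlgHom.commutes]; exact Algebra.commutes r z
  | grade1 t => exact h t
  | mul a b ha hb => rw [map_mul, mul_assoc, hb, ← mul_assoc, ha, mul_assoc]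
  | add a b ha hb => rw [map_add, add_mul, mul_add, ha, hb]

lemma uu_comm {n : ℕ} (hn : 1 ≤ n) (x : PiT n) : x * uu n = uu n * x := by
  refine comm_all _ (fun t => ?_) x
  cases t with
  | e i => rw [gen_e, eps_uu]
  | a i => rw [gen_a, uu_al]
  | astar i => rw [gen_astar, uu_be]
  | b => exact uu_bb hn

lemma upow_comm {n : ℕ} (hn : 1 ≤ n) (k : ℕ) (x : PiT n) : x * uu n ^ k = uu n ^ k * x :=
  ((show Commute x (uu n) from uu_comm hn x).pow_right k)

lemma upow_eps_zero {n : ℕ} (hn : 1 ≤ n) (j : ℕ) : uu n ^ (j+1) * eps n j = 0 := by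
  induction j with
  | zero => simp [uu_eps_zero]
  | succ j ih =>
    by_cases h : j + 1 < n
    · rw [pow_succ, mul_assoc, ← al_be h, ← eps_be, ← mul_assoc, ← upow_comm hn, mul_assoc,
        ← mul_assoc (uu n ^ _), ih, zero_mul, mul_zero]
    · simp [eps_ge (not_lt.mp h)]

lemma upow_eps_lt {n : ℕ} (hn : 1 ≤ n) {j k : ℕ} (h : j < k) : uu n ^ k * eps n j = 0 := by
  obtain ⟨m, rfl⟩ := Nat.exists_eq_add_of_le (show j + 1 ≤ k from h)
  rw [add_comm, pow_add, mul_assoc, upow_eps_zero hn, mul_zero]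

lemma upow_eps_pow {n : ℕ} (hn : 1 ≤ n) (j k : ℕ) :
    (uu n * eps n j) ^ (k+1) = uu n ^ (k+1) * eps n j := by
  have h : Commute (uu n) (eps n j) := (uu_comm hn _).symm
  rw [h.mul_pow]
  congr 1
  exact IsIdempotentElem.pow_succ_eq k (eps_self n j)

lemma zz_eq {n : ℕ} (hn : 1 ≤ n) (k : ℕ) : zz n k = uu n ^ k := by
  have : uu n ^ k = ∑ j ∈ Finset.range n, uu n ^ k * eps n j := by
    rw [← Finset.mul_sum, sum_eps, mul_one]
  rw [this, zz, Finset.sum_range]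
  refine Finset.sum_congr rfl fun j _ => ?_
  split_ifs with h
  · unfold cpath
    split_ifs with h0 h1
    · simp [h0, gen_e]
    · obtain ⟨k, rfl⟩ := Nat.exists_eq_succ_of_ne_zero h0
      rw [gen_a, gen_astar]
      simp only
      rw [al_be (by omega), upow_eps_pow hn, show (j : ℕ) - 1 + 1 = j by omega]
    · omega
  · rw [upow_eps_lt hn (not_le.mp h)]

/-- up path from `i` to `i+m`. -/
def Up (n i : ℕ) : ℕ → PiT n
  | 0 => eps n i
  | m+1 => al n (i+m) * Up n i m

/-- down path from `j+m` to `j`. -/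
def Dn (n : ℕ) : ℕ → ℕ → PiT n
  | 0, j => eps n j
  | m+1, j => be n j * Dn n m (j+1)

lemma eps_Up (n i m : ℕ) : eps n (i+m) * Up n i m = Up n i m := by
  cases m with
  | zero => exact eps_self n i
  | succ m => rw [Up, ← mul_assoc, ← add_assoc, eps_al]
lemma Up_eps (n i m : ℕ) : Up n i m * eps n i = Up n i m := by
  induction m with
  | zero => exact eps_self n i
  | succ m ih => rw [Up, mul_assoc, ih]
lemma eps_Dn (n j m : ℕ) : eps n j * Dn n m j = Dn n m j := by
  cases m with
  | zero => exact eps_self n j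
  | succ m => rw [Dn, ← mul_assoc, eps_be]
lemma Dn_eps (n j m : ℕ) : Dn n m j * eps n (j+m) = Dn n m j := by
  induction m generalizing j with
  | zero => exact eps_self n j
  | succ m ih => rw [Dn, mul_assoc, show j + (m+1) = j+1+m by omega, ih]

/-- spanning elements of degree `d` -/
inductive Sp (n d : ℕ) : PiT n → Prop
  | up (k i m : ℕ) (h : 2*k+m = d) (h' : i + m < n) : Sp n d (uu n ^ k * Up n i m)
  | dn (k j m : ℕ) (h : 2*k+m = d) (h' : j + m < n) : Sp n d (uu n ^ k * Dn n m j)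
  | loop (k j m i l : ℕ) (h : 2*k+m+l+1 = d) (hm : j + m + 1 = n) (hl : i + l + 1 = n) :
      Sp n d (uu n ^ k * (Dn n m j * (bb n * Up n i l)))

def NN (n d : ℕ) : Submodule ℂ (PiT n) := Submodule.span ℂ {x | Sp n d x}

lemma Sp.mem {n d : ℕ} {x : PiT n} (h : Sp n d x) : x ∈ NN n d := Submodule.subset_span h

/-- every spanning element starts at a target vertex -/
lemma eps_mul_Sp {n : ℕ} (hn : 1 ≤ n) {d : ℕ} {x : PiT n} (h : Sp n d x) :
    ∃ i, i < n ∧ eps n i * x = x := by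
  cases h with
  | up k i m h h' =>
    exact ⟨i+m, h', by rw [← mul_assoc, upow_comm hn, mul_assoc, eps_Up]⟩
  | dn k j m h h' =>
    exact ⟨j, by omega, by rw [← mul_assoc, upow_comm hn, mul_assoc, eps_Dn]⟩
  | loop k j m i l h hm hl =>
    exact ⟨j, by omega, by
      rw [← mul_assoc, upow_comm hn, mul_assoc, ← mul_assoc (eps n j), eps_Dn]⟩

lemma e_Sp {n : ℕ} (hn : 1 ≤ n) {d : ℕ} {x : PiT n} (h : Sp n d x) (j : ℕ) :
    eps n j * x ∈ NN n d := by
  obtain ⟨i, hi, hx⟩ := eps_mul_Sp hn h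
  by_cases hij : j = i
  · rw [hij, hx]; exact h.mem
  · rw [← hx, ← mul_assoc, eps_ne hij, zero_mul]; exact zero_mem _

lemma al_Sp {n : ℕ} (hn : 1 ≤ n) {d : ℕ} {x : PiT n} (h : Sp n d x) (t : ℕ) :
    al n t * x ∈ NN n (d+1) := by
  by_cases ht : t + 1 < n
  swap
  · rw [al_ge (by omega), zero_mul]; exact zero_mem _
  cases h with
  | up k i m h h' =>
    rw [← mul_assoc, upow_comm hn, mul_assoc]
    by_cases e : t = i + m
    · subst e
      exact (Sp.up k i (m+1) (by omega) (by omega)).mem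
    · rw [← eps_Up, ← mul_assoc (al n t), al_eps_ne e, zero_mul, mul_zero]; exact zero_mem _
  | dn k j m h h' =>
    rw [← mul_assoc, upow_comm hn, mul_assoc]
    by_cases e : t = j
    · subst e
      cases m with
      | zero => exact (Sp.up k t 1 (by omega) (by omega)).mem
      | succ m =>
        rw [Dn, ← mul_assoc (al n t), al_be ht, mul_assoc, eps_Dn, ← mul_assoc, ← pow_succ]
        exact (Sp.dn (k+1) (t+1) m (by omega) (by omega)).mem
    · rw [← eps_Dn, ← mul_assoc (al n t), al_eps_ne e, zero_mul, mul_zero]; exact zero_mem _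
  | loop k j m i l h hm hl =>
    rw [← mul_assoc, upow_comm hn, mul_assoc, ← mul_assoc (al n t)]
    by_cases e : t = j
    · subst e
      cases m with
      | zero => omega
      | succ m =>
        rw [Dn, ← mul_assoc (al n t), al_be ht, mul_assoc (uu n), eps_Dn, mul_assoc (uu n),
          ← mul_assoc, ← pow_succ]
        exact (Sp.loop (k+1) (t+1) m i l (by omega) (by omega) (by omega)).mem
    · rw [← eps_Dn, ← mul_assoc (al n t), al_eps_ne e, zero_mul, zero_mul, mul_zero]
      exact zero_mem _

lemma be_Sp {n : ℕ} (hn : 1 ≤ n) {d : ℕ} {x : PiT n} (h : Sp n d x) (t : ℕ) :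
    be n t * x ∈ NN n (d+1) := by
  by_cases ht : t + 1 < n
  swap
  · rw [be_ge (by omega), zero_mul]; exact zero_mem _
  cases h with
  | up k i m h h' =>
    rw [← mul_assoc, upow_comm hn, mul_assoc]
    by_cases e : t + 1 = i + m
    · cases m with
      | zero =>
        obtain rfl : i = t + 1 := by omega
        exact (Sp.dn k t 1 (by omega) (by omega)).mem
      | succ m =>
        obtain rfl : t = i + m := by omega
        rw [Up, ← mul_assoc (be n _), be_al ht, mul_assoc, eps_Up, ← mul_assoc, ← pow_succ]
        exact (Sp.up (k+1) i m (by omega) (by omega)).mem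
    · rw [← eps_Up, ← mul_assoc (be n t), be_eps_ne e, zero_mul, mul_zero]; exact zero_mem _
  | dn k j m h h' =>
    rw [← mul_assoc, upow_comm hn, mul_assoc]
    by_cases e : t + 1 = j
    · subst e
      exact (Sp.dn k t (m+1) (by omega) (by omega)).mem
    · rw [← eps_Dn, ← mul_assoc (be n t), be_eps_ne e, zero_mul, mul_zero]; exact zero_mem _
  | loop k j m i l h hm hl =>
    rw [← mul_assoc, upow_comm hn, mul_assoc, ← mul_assoc (be n t)]
    by_cases e : t + 1 = j
    · subst e
      exact (Sp.loop k t (m+1) i l (by omega) (by omega) (by omega)).mem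
    · rw [← eps_Dn, ← mul_assoc (be n t), be_eps_ne e, zero_mul, zero_mul, mul_zero]
      exact zero_mem _

lemma bb_Sp {n : ℕ} (hn : 1 ≤ n) {d : ℕ} {x : PiT n} (h : Sp n d x) :
    bb n * x ∈ NN n (d+1) := by
  cases h with
  | up k i m h h' =>
    rw [← mul_assoc, upow_comm hn, mul_assoc]
    by_cases e : i + m = n - 1
    · rw [← eps_bb hn, mul_assoc]
      exact (Sp.loop k (n-1) 0 i m (by omega) (by omega) (by omega)).mem
    · rw [← eps_Up, ← mul_assoc (bb n), bb_eps_ne hn e, zero_mul, mul_zero]; exact zero_mem _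
  | dn k j m h h' =>
    rw [← mul_assoc, upow_comm hn, mul_assoc]
    by_cases e : j = n - 1
    · obtain rfl : m = 0 := by omega
      subst e
      have := (Sp.loop (n := n) (d := d+1) k (n-1) 0 (n-1) 0 (by omega) (by omega) (by omega)).mem
      simpa [Dn, Up, bb_eps hn, eps_bb hn] using this
    · rw [← eps_Dn, ← mul_assoc (bb n), bb_eps_ne hn e, zero_mul, mul_zero]; exact zero_mem _
  | loop k j m i l h hm hl =>
    rw [← mul_assoc, upow_comm hn, mul_assoc, ← mul_assoc (bb n)]
    by_cases e : j = n - 1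
    · obtain rfl : m = 0 := by omega
      subst e
      rw [Dn, bb_eps hn, ← mul_assoc (bb n), bb_bb hn, mul_assoc,
        show n - 1 = i + l by omega, eps_Up, ← mul_assoc, ← pow_succ]
      exact (Sp.up (k+1) i l (by omega) (by omega)).mem
    · rw [← eps_Dn, ← mul_assoc (bb n), bb_eps_ne hn e, zero_mul, zero_mul, mul_zero]
      exact zero_mem _

lemma mul_NN {n d d' : ℕ} (g x : PiT n) (hg : ∀ y, Sp n d y → g * y ∈ NN n d')
    (hx : x ∈ NN n d) : g * x ∈ NN n d' := by
  have : NN n d ≤ (NN n d').comap (LinearMap.mulLeft ℂ g) :=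
    Submodule.span_le.mpr fun y hy => hg y hy
  exact this hx

lemma adeg_le {n : ℕ} (hn : 1 ≤ n) (d : ℕ) : adeg n d ≤ NN n d := by
  refine Submodule.span_le.mpr ?_
  rintro x ⟨l, hl, rfl⟩
  induction l generalizing d with
  | nil =>
    simp only [List.map_nil, List.sum_nil] at hl
    subst hl
    simp only [List.map_nil, List.prod_nil, SetLike.mem_coe]
    rw [← sum_eps]
    refine Submodule.sum_mem _ fun i hi => ?_
    have := (Sp.up (n := n) (d := 0) 0 i 0 rfl (by simpa using hi)).mem
    simpa [Up] using this
  | cons t l ih =>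
    simp only [List.map_cons, List.sum_cons] at hl
    simp only [List.map_cons, List.prod_cons, SetLike.mem_coe]
    have ih' := ih _ rfl
    cases t with
    | e i =>
      have : d = (l.map wt).sum := by simpa [wt] using hl.symm
      rw [gen_e, this]
      exact mul_NN _ _ (fun y hy => e_Sp hn hy _) ih'
    | a i =>
      have : d = (l.map wt).sum + 1 := by rw [← hl, add_comm]; rfl
      rw [gen_a, this]
      exact mul_NN _ _ (fun y hy => al_Sp hn hy _) ih'
    | astar i =>
      have : d = (l.map wt).sum + 1 := by rw [← hl, add_comm]; rfl
      rw [gen_astar, this]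
      exact mul_NN _ _ (fun y hy => be_Sp hn hy _) ih'
    | b =>
      have : d = (l.map wt).sum + 1 := by rw [← hl, add_comm]; rfl
      rw [this]
      exact mul_NN _ _ (fun y hy => bb_Sp hn hy) ih'

lemma eNe {n d : ℕ} (i : ℕ) (P : Submodule ℂ (PiT n))
    (h : ∀ y, Sp n d y → eps n i * y * eps n i ∈ P) {x : PiT n} (hx : x ∈ NN n d) :
    eps n i * x * eps n i ∈ P := by
  have : NN n d ≤ P.comap (LinearMap.mulRight ℂ (eps n i) ∘ₗ LinearMap.mulLeft ℂ (eps n i)) :=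
    Submodule.span_le.mpr fun y hy => h y hy
  exact this hx

lemma Up_diag {n : ℕ} (i j m : ℕ) (h : i ≠ j ∨ m ≠ 0) : eps n i * Up n j m * eps n i = 0 := by
  rw [← Up_eps, mul_assoc, mul_assoc]
  by_cases e : j = i
  · rw [← eps_Up, ← mul_assoc (eps n i), ← mul_assoc (eps n i), eps_ne (by omega), zero_mul,
      zero_mul]
  · rw [eps_ne e, mul_zero, mul_zero]
lemma Dn_diag {n : ℕ} (i j m : ℕ) (h : i ≠ j ∨ m ≠ 0) : eps n i * Dn n m j * eps n i = 0 := by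
  rw [← Dn_eps, mul_assoc, mul_assoc]
  by_cases e : j + m = i
  · rw [← eps_Dn, ← mul_assoc (eps n i), ← mul_assoc (eps n i), eps_ne (by omega), zero_mul,
      zero_mul]
  · rw [eps_ne e, mul_zero, mul_zero]

lemma even_diag {n : ℕ} (hn : 1 ≤ n) {k i : ℕ} {x : PiT n} (hx : x ∈ NN n (2*k)) :
    ∃ c : ℂ, c • (uu n ^ k * eps n i) = eps n i * x * eps n i := by
  rw [← Submodule.mem_span_singleton]
  refine eNe i _ (fun y hy => ?_) hx
  cases hy with
  | up k' j m h h' =>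
    rw [← mul_assoc, upow_comm hn, mul_assoc, mul_assoc, ← mul_assoc (eps n i)]
    by_cases e : i ≠ j ∨ m ≠ 0
    · rw [Up_diag _ _ _ e, mul_zero]; exact zero_mem _
    · push Not at e
      obtain ⟨rfl, rfl⟩ := e
      obtain rfl : k' = k := by omega
      rw [Up, eps_self, eps_self]; exact Submodule.mem_span_singleton_self _
  | dn k' j m h h' =>
    rw [← mul_assoc, upow_comm hn, mul_assoc, mul_assoc, ← mul_assoc (eps n i)]
    by_cases e : i ≠ j ∨ m ≠ 0
    · rw [Dn_diag _ _ _ e, mul_zero]; exact zero_mem _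
    · push Not at e
      obtain ⟨rfl, rfl⟩ := e
      obtain rfl : k' = k := by omega
      rw [Dn, eps_self, eps_self]; exact Submodule.mem_span_singleton_self _
  | loop k' j m j' l h hm hl =>
    rw [← mul_assoc, upow_comm hn]
    by_cases e : j = i
    · by_cases e' : j' = i
      · omega
      · rw [← Up_eps]
        simp only [mul_assoc]
        rw [eps_ne e']; simp
    · rw [← eps_Dn]
      simp only [mul_assoc]
      rw [← mul_assoc (eps n i), eps_ne (Ne.symm e)]; simp

lemma odd_diag {n : ℕ} (hn : 1 ≤ n) {k i : ℕ} {x : PiT n} (hx : x ∈ NN n (2*k+1)) :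
    (∃ k' l, i + l + 1 = n ∧ k' + l = k ∧
      ∃ c : ℂ, c • (uu n ^ k' * (Dn n l i * (bb n * Up n i l))) = eps n i * x * eps n i) ∨
    (k + i + 1 < n ∨ n ≤ i) ∧ eps n i * x * eps n i = 0 := by
  by_cases hc : k + i + 1 < n ∨ n ≤ i
  · right
    refine ⟨hc, ?_⟩
    rw [← Submodule.mem_bot ℂ]
    rcases hc with hc | hc
    swap
    · simp [eps_ge hc]
    refine eNe i _ (fun y hy => ?_) hx
    cases hy with
    | up k' j m h h' =>
      rw [← mul_assoc (eps n i), upow_comm hn, mul_assoc, mul_assoc, ← mul_assoc (eps n i) (_ : PiT n) (eps n i),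
        Up_diag _ _ _ (by omega), mul_zero]; exact zero_mem _
    | dn k' j m h h' =>
      rw [← mul_assoc (eps n i), upow_comm hn, mul_assoc, mul_assoc, ← mul_assoc (eps n i) (_ : PiT n) (eps n i),
        Dn_diag _ _ _ (by omega), mul_zero]; exact zero_mem _
    | loop k' j m j' l h hm hl =>
      rw [← mul_assoc (eps n i), upow_comm hn]
      by_cases e : j = i
      · by_cases e' : j' = i
        · omega
        · rw [← Up_eps n j' l]
          simp only [mul_assoc]
          rw [eps_ne e']; simp
      · rw [← eps_Dn n j m]
        simp only [mul_assoc]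
        rw [← mul_assoc (eps n i), eps_ne (Ne.symm e)]; simp
  · left
    push Not at hc
    refine ⟨k - (n - 1 - i), n - 1 - i, by omega, by omega, ?_⟩
    rw [← Submodule.mem_span_singleton]
    refine eNe i _ (fun y hy => ?_) hx
    cases hy with
    | up k' j m h h' =>
      rw [← mul_assoc (eps n i), upow_comm hn, mul_assoc, mul_assoc, ← mul_assoc (eps n i) (_ : PiT n) (eps n i),
        Up_diag _ _ _ (by omega), mul_zero]; exact zero_mem _
    | dn k' j m h h' =>
      rw [← mul_assoc (eps n i), upow_comm hn, mul_assoc, mul_assoc, ← mul_assoc (eps n i) (_ : PiT n) (eps n i),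
        Dn_diag _ _ _ (by omega), mul_zero]; exact zero_mem _
    | loop k' j m j' l h hm hl =>
      rw [← mul_assoc (eps n i), upow_comm hn]
      by_cases e : j = i
      · by_cases e' : j' = i
        · subst e
          subst e'
          obtain rfl : m = n - 1 - j' := by omega
          obtain rfl : l = n - 1 - j' := by omega
          obtain rfl : k' = k - (n - 1 - j') := by omega
          simp only [mul_assoc]
          rw [Up_eps, ← mul_assoc (eps n j'), eps_Dn]
          exact Submodule.mem_span_singleton_self _
        · rw [← Up_eps n j' l]
          simp only [mul_assoc]
          rw [eps_ne e']; simp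
      · rw [← eps_Dn n j m]
        simp only [mul_assoc]
        rw [← mul_assoc (eps n i), eps_ne (Ne.symm e)]; simp

/-! ### A family of explicit modules, used for the nonvanishing statements -/

abbrev VV := (ℤ × ℤ) →₀ ℂ

/-- The rectangle. -/
abbrev RR (n s : ℕ) (p : ℤ × ℤ) : Prop :=
  0 ≤ p.1 ∧ p.1 + s + 1 ≤ 2 * n ∧ 0 ≤ p.2 ∧ p.2 ≤ s

def dl (n s : ℕ) (x y : ℤ) : VV := if RR n s (x, y) then Finsupp.single (x, y) 1 else 0

def fe (n s j : ℕ) (p : ℤ × ℤ) : VV :=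
  if (RR n s p ∧ (s + p.1 - p.2 = j ∨ s + p.1 - p.2 = 2 * n - 1 - j)) ∨ (¬ RR n s p ∧ j = 0)
  then Finsupp.single p 1 else 0

def fa (n s j : ℕ) (p : ℤ × ℤ) : VV :=
  if RR n s p ∧ j + 1 < n then
    if s + p.1 - p.2 = j then dl n s (p.1 + 1) p.2
    else if s + p.1 - p.2 = 2 * n - 1 - j then dl n s p.1 (p.2 + 1) else 0
  else 0

def fas (n s j : ℕ) (p : ℤ × ℤ) : VV :=
  if RR n s p ∧ j + 1 < n then
    if s + p.1 - p.2 = j + 1 then dl n s p.1 (p.2 + 1)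
    else if s + p.1 - p.2 = 2 * n - 2 - j then dl n s (p.1 + 1) p.2 else 0
  else 0

def fb (n s : ℕ) (p : ℤ × ℤ) : VV :=
  if RR n s p then
    if s + p.1 - p.2 = n - 1 then dl n s (p.1 + 1) p.2
    else if s + p.1 - p.2 = n then dl n s p.1 (p.2 + 1) else 0
  else 0

def op (f : ℤ × ℤ → VV) : Module.End ℂ VV := Finsupp.linearCombination ℂ f

lemma op_single (f : ℤ × ℤ → VV) (p : ℤ × ℤ) : op f (Finsupp.single p 1) = f p := by
  simp [op]

lemma op_dl (f : ℤ × ℤ → VV) (n s : ℕ) (x y : ℤ) :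
    op f (dl n s x y) = if RR n s (x, y) then f (x, y) else 0 := by
  unfold dl
  split_ifs <;> simp [op]

lemma end_ext {f g : Module.End ℂ VV}
    (h : ∀ x y : ℤ, f (Finsupp.single (x, y) 1) = g (Finsupp.single (x, y) 1)) : f = g := by
  refine Finsupp.lhom_ext' fun p => LinearMap.ext_ring ?_
  exact h p.1 p.2

def rgen (n s : ℕ) : TGen n → Module.End ℂ VV
  | .e j => op (fe n s j)
  | .a j => op (fa n s j)
  | .astar j => op (fas n s j)
  | .b => op (fb n s)

lemma op_ite (f : ℤ × ℤ → VV) (P : Prop) [Decidable P] (u v : VV) :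
    op f (if P then u else v) = if P then op f u else op f v := by split_ifs <;> rfl

lemma as_a (n s j : ℕ) (x y : ℤ) : op (fas n s j) (fa n s j (x, y)) =
    if j + 1 < n ∧ RR n s (x,y) ∧ (s + x - y = j ∨ s + x - y = 2 * n - 1 - j) then
      dl n s (x+1) (y+1) else 0 := by
  unfold fa
  simp only [op_ite, op_dl, map_zero]
  unfold fas dl
  simp only [RR]
  split_ifs <;> first | rfl | (exfalso; omega)

lemma a_as (n s j : ℕ) (x y : ℤ) : op (fa n s j) (fas n s j (x, y)) =
    if j + 1 < n ∧ RR n s (x,y) ∧ (s + x - y = (j+1 : ℕ) ∨ s + x - y = 2 * n - 1 - (j+1 : ℕ)) then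
      dl n s (x+1) (y+1) else 0 := by
  unfold fas
  simp only [op_ite, op_dl, map_zero]
  unfold fa dl
  simp only [RR]
  split_ifs <;> first | rfl | (exfalso; omega)

lemma b_b (n s : ℕ) (hn : 1 ≤ n) (x y : ℤ) : op (fb n s) (fb n s (x, y)) =
    if RR n s (x,y) ∧ (s + x - y = (n-1 : ℕ) ∨ s + x - y = 2 * n - 1 - (n-1 : ℕ)) then
      dl n s (x+1) (y+1) else 0 := by
  rw [fb]
  simp only [op_ite, op_dl, map_zero]
  unfold fb dl
  simp only [RR]
  split_ifs <;> first | rfl | (exfalso; omega)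

lemma e_dl (n s j : ℕ) (x y : ℤ) : op (fe n s j) (dl n s x y) =
    if s + x - y = j ∨ s + x - y = 2 * n - 1 - j then dl n s x y else 0 := by
  rw [op_dl]
  unfold fe dl
  split_ifs <;> first | rfl | tauto

lemma rho_rel (n s : ℕ) (hn : 1 ≤ n) (hs : s < n) ⦃x y : F n⦄ (h : TRel n x y) :
    FreeAlgebra.lift ℂ (rgen n s) x = FreeAlgebra.lift ℂ (rgen n s) y := by
  cases h with
  | idem i j =>
    simp only [g, map_mul, FreeAlgebra.lift_ι_apply, rgen]
    apply end_ext; intro x y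
    rw [apply_ite (FreeAlgebra.lift ℂ (rgen n s))]
    simp only [FreeAlgebra.lift_ι_apply, rgen, map_zero, Module.End.mul_apply, op_single]
    by_cases hij : i = j
    · subst hij
      simp only [if_true, op_single]
      unfold fe
      split_ifs with h
      · rw [op_single, if_pos h]
      · simp
    · have : (i : ℕ) ≠ j := fun h => hij (Fin.ext h)
      have h1 := i.2
      have h2 := j.2
      simp only [if_neg hij]
      unfold fe
      split_ifs with h
      · rw [op_single, if_neg]
        · rfl
        · unfold RR at *
          simp only at *
          omega
      · simp
  | sum_idem =>
    simp only [g, map_sum, FreeAlgebra.lift_ι_apply, rgen, map_one]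
    apply end_ext; intro x y
    rw [LinearMap.sum_apply]
    simp only [op_single, Module.End.one_apply]
    rw [← Finset.sum_range (fun j => fe n s j (x, y))]
    by_cases hR : RR n s (x, y)
    · have hv : ∃ j : ℕ, j < n ∧ (s + x - y = j ∨ s + x - y = 2 * n - 1 - j) := by
        unfold RR at hR
        simp only at hR
        by_cases hh : (s : ℤ) + x - y < n
        · exact ⟨(s + x - y).toNat, by omega, by omega⟩
        · exact ⟨(2 * n - 1 - (s + x - y)).toNat, by omega, by omega⟩
      obtain ⟨j, hj, hv⟩ := hv
      rw [Finset.sum_eq_single j]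
      · unfold fe; rw [if_pos (Or.inl ⟨hR, hv⟩)]
      · intro i hi hij
        rw [Finset.mem_range] at hi
        unfold fe; rw [if_neg]
        simp only [hR, true_and, not_true, false_and, or_false]
        omega
      · intro h; simp at h; omega
    · rw [Finset.sum_eq_single 0]
      · unfold fe; rw [if_pos (Or.inr ⟨hR, rfl⟩)]
      · intro i hi hij
        unfold fe; rw [if_neg]
        tauto
      · intro h; simp at h; omega
  | a_path i h =>
    simp only [g, map_mul, FreeAlgebra.lift_ι_apply, rgen]
    apply end_ext; intro x y
    simp only [Module.End.mul_apply, op_single]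
    rw [fe]
    split
    · rw [op_single]
      unfold fa
      simp only [op_ite, map_zero]
      rw [e_dl, e_dl]
      unfold dl
      simp only [RR]
      split_ifs <;> first | rfl | (exfalso; push_cast at *; omega)
    · simp only [map_zero]
      unfold fa
      split_ifs <;> first | rfl | (exfalso; unfold RR at *; simp only at *; omega)
  | a_junk i h =>
    simp only [g, FreeAlgebra.lift_ι_apply, rgen, map_zero]
    apply end_ext; intro x y
    rw [op_single, fa, if_neg (by tauto)]; rfl
  | astar_path i h =>
    simp only [g, map_mul, FreeAlgebra.lift_ι_apply, rgen]
    apply end_ext; intro x y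
    simp only [Module.End.mul_apply, op_single]
    rw [fe]
    split
    · rw [op_single]
      unfold fas
      simp only [op_ite, map_zero]
      rw [e_dl, e_dl]
      unfold dl
      simp only [RR]
      split_ifs <;> first | rfl | (exfalso; push_cast at *; omega)
    · simp only [map_zero]
      unfold fas
      split_ifs <;> first | rfl | (exfalso; unfold RR at *; simp only at *; omega)
  | astar_junk i h =>
    simp only [g, FreeAlgebra.lift_ι_apply, rgen, map_zero]
    apply end_ext; intro x y
    rw [op_single, fas, if_neg (by tauto)]; rfl
  | b_path i h =>
    simp only [g, map_mul, FreeAlgebra.lift_ι_apply, rgen]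
    apply end_ext; intro x y
    simp only [Module.End.mul_apply, op_single]
    rw [fe]
    split
    · rw [op_single]
      unfold fb
      simp only [op_ite, map_zero]
      rw [e_dl, e_dl]
      unfold dl
      simp only [RR]
      split_ifs <;> first | rfl | (exfalso; push_cast at *; omega)
    · simp only [map_zero]
      unfold fb
      split_ifs <;> first | rfl | (exfalso; unfold RR at *; simp only at *; omega)
  | preproj =>
    simp only [g, map_mul, map_sum, map_sub, FreeAlgebra.lift_ι_apply, rgen]
    apply end_ext; intro x y
    rw [LinearMap.sum_apply]
    simp only [LinearMap.sub_apply, Module.End.mul_apply, op_single]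
    rw [b_b n s hn]
    simp only [a_as, as_a]
    let G : ℕ → VV := fun j => if RR n s (x,y) ∧ (s + x - y = (j : ℕ) ∨
      s + x - y = 2 * n - 1 - (j : ℕ)) then dl n s (x+1) (y+1) else 0
    have hG0 : G 0 = 0 := by
      simp only [G, dl, RR]
      split_ifs <;> first | rfl | (exfalso; omega)
    obtain ⟨m, rfl⟩ : ∃ m, n = m + 1 := ⟨n - 1, by omega⟩
    rw [Fin.sum_univ_castSucc]
    simp only [Fin.val_last, Fin.val_castSucc, lt_irrefl, false_and, if_false, sub_zero, add_zero]
    have : ∀ j : Fin m, ((j : ℕ) + 1 < m + 1) := fun j => by omega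
    simp only [this, true_and]
    rw [← Finset.sum_range (fun j => G (j+1) - G j), Finset.sum_range_sub, hG0, sub_zero]
    rfl

def rho (n s : ℕ) (hn : 1 ≤ n) (hs : s < n) : PiT n →ₐ[ℂ] Module.End ℂ VV :=
  RingQuot.liftAlgHom ℂ ⟨FreeAlgebra.lift ℂ (rgen n s), rho_rel n s hn hs⟩

lemma rho_gen (n s : ℕ) (hn : 1 ≤ n) (hs : s < n) (t : TGen n) :
    rho n s hn hs (gen t) = rgen n s t := by
  simp [rho, gen, g]

lemma dl_ne {n s : ℕ} {x y : ℤ} (h : RR n s (x,y)) : dl n s x y ≠ 0 := by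
  simp [dl, h]

lemma rho_al {n s : ℕ} (hn : 1 ≤ n) (hs : s < n) {j : ℕ} (hj : j + 1 < n) {x y : ℤ}
    (hR : RR n s (x,y)) (h : s + x - y = j) :
    rho n s hn hs (al n j) (dl n s x y) = dl n s (x+1) y := by
  rw [al, dif_pos hj, rho_gen, rgen, op_dl, if_pos hR, fa, if_pos ⟨hR, hj⟩, if_pos h]

lemma rho_be {n s : ℕ} (hn : 1 ≤ n) (hs : s < n) {j : ℕ} (hj : j + 1 < n) {x y : ℤ}
    (hR : RR n s (x,y)) (h : s + x - y = j + 1) :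
    rho n s hn hs (be n j) (dl n s x y) = dl n s x (y+1) := by
  rw [be, dif_pos hj, rho_gen, rgen, op_dl, if_pos hR, fas, if_pos ⟨hR, hj⟩, if_pos h]

lemma rho_be' {n s : ℕ} (hn : 1 ≤ n) (hs : s < n) {j : ℕ} (hj : j + 1 < n) {x y : ℤ}
    (hR : RR n s (x,y)) (h : s + x - y = 2 * n - 2 - j) :
    rho n s hn hs (be n j) (dl n s x y) = dl n s (x+1) y := by
  rw [be, dif_pos hj, rho_gen, rgen, op_dl, if_pos hR, fas, if_pos ⟨hR, hj⟩, if_neg, if_pos h]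
  simp only; omega

lemma rho_bb {n s : ℕ} (hn : 1 ≤ n) (hs : s < n) {x y : ℤ}
    (hR : RR n s (x,y)) (h : s + x - y = n - 1) :
    rho n s hn hs (bb n) (dl n s x y) = dl n s (x+1) y := by
  rw [bb, rho_gen, rgen, op_dl, if_pos hR, fb, if_pos hR, if_pos h]

lemma rho_e {n s : ℕ} (hn : 1 ≤ n) (hs : s < n) {j : ℕ} (hj : j < n) {x y : ℤ}
    (h : s + x - y = j ∨ s + x - y = 2 * n - 1 - j) :
    rho n s hn hs (eps n j) (dl n s x y) = dl n s x y := by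
  rw [eps, dif_pos hj, rho_gen, rgen, e_dl, if_pos h]

/-- `(a* a)^k` at the starting vertex. -/
lemma rho_pow {n s : ℕ} (hn : 1 ≤ n) (hs : s + 1 < n) (k : ℕ) (hk : k ≤ s) :
    rho n s hn (by omega) ((be n s * al n s) ^ k) (dl n s 0 0) = dl n s k k := by
  induction k with
  | zero => simp
  | succ k ih =>
    rw [pow_succ', map_mul, Module.End.mul_apply, ih (by omega), map_mul, Module.End.mul_apply,
      rho_al hn _ hs (by simp only [RR]; omega) (by omega),
      rho_be hn _ hs (by simp only [RR]; omega) (by omega)]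
    push_cast; rfl

lemma rho_Up {n s : ℕ} (hn : 1 ≤ n) (hs : s < n) (i m : ℕ) (x y : ℤ) (hR : RR n s (x,y))
    (h : s + x - y = i) (him : i + m < n) (hR' : RR n s (x+m, y)) :
    rho n s hn hs (Up n i m) (dl n s x y) = dl n s (x+m) y := by
  induction m with
  | zero =>
    rw [Up, rho_e hn hs (by omega) (Or.inl h)]; simp
  | succ m ih =>
    have hR2 : RR n s (x+m, y) := by simp only [RR] at *; omega
    rw [Up, map_mul, Module.End.mul_apply, ih (by omega) hR2, rho_al hn hs (by omega) hR2 (by omega)]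
    push_cast; rw [add_assoc]

lemma rho_Dn {n s : ℕ} (hn : 1 ≤ n) (hs : s < n) (j m : ℕ) (x y : ℤ) (hR : RR n s (x,y))
    (h : s + x - y = 2 * n - 1 - (j + m)) (him : j + m < n) (hR' : RR n s (x+m, y)) :
    rho n s hn hs (Dn n m j) (dl n s x y) = dl n s (x+m) y := by
  induction m generalizing j with
  | zero =>
    rw [Dn, rho_e hn hs (by omega) (Or.inr (by omega))]; simp
  | succ m ih =>
    have hR2 : RR n s (x+m, y) := by simp only [RR] at *; omega
    rw [Dn, map_mul, Module.End.mul_apply, ih (j+1) (by push_cast at *; omega) (by omega) hR2,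
      rho_be' hn hs (by omega) hR2 (by push_cast at *; omega)]
    push_cast; rw [add_assoc]

lemma upow_al {n : ℕ} (hn : 1 ≤ n) {i : ℕ} (hi : i + 1 < n) (k : ℕ) :
    uu n ^ k * al n i = al n i * (be n i * al n i) ^ k := by
  cases k with
  | zero => simp
  | succ k => rw [be_al hi, upow_eps_pow hn, ← mul_assoc, upow_comm hn, mul_assoc, al_eps]

lemma upow_al_ne {n : ℕ} (hn : 1 ≤ n) {i : ℕ} (hi : i + 1 < n) {k : ℕ} (hk : k ≤ i) :
    uu n ^ k * al n i ≠ 0 := by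
  intro h
  rw [upow_al hn hi] at h
  have := congrArg (fun z => rho n i hn (by omega) z (dl n i 0 0)) h
  simp only [map_zero, LinearMap.zero_apply] at this
  rw [map_mul, Module.End.mul_apply, rho_pow hn hi k hk,
    rho_al hn _ hi (by simp only [RR]; omega) (by omega)] at this
  exact dl_ne (by simp only [RR]; omega) this

lemma loop_ne {n : ℕ} (hn : 1 ≤ n) {i l : ℕ} (hi : i + 1 + l + 1 = n) {k : ℕ} (hk : k ≤ i) :
    uu n ^ k * (Dn n l (i+1) * (bb n * Up n (i+1) l)) * al n i ≠ 0 := by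
  intro h
  rw [← upow_comm hn, mul_assoc, upow_al hn (by omega)] at h
  have := congrArg (fun z => rho n i hn (by omega) z (dl n i 0 0)) h
  simp only [map_zero, LinearMap.zero_apply] at this
  rw [map_mul, map_mul, map_mul, map_mul (rho _ _ _ _) (al n i)] at this
  simp only [Module.End.mul_apply] at this
  rw [rho_pow hn (by omega) k hk,
    rho_al hn _ (by omega) (by simp only [RR]; omega) (by omega),
    rho_Up hn _ _ _ _ _ (by simp only [RR]; omega) (by push_cast; omega) (by omega)
      (by simp only [RR]; omega),
    rho_bb hn _ (by simp only [RR]; omega) (by omega),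
    rho_Dn hn _ _ _ _ _ (by simp only [RR]; omega) (by push_cast; omega) (by omega)
      (by simp only [RR]; omega)] at this
  exact dl_ne (by simp only [RR]; omega) this

lemma central_sum {n : ℕ} (x : PiT n) (hx : ∀ y, y * x = x * y) :
    x = ∑ i ∈ Finset.range n, eps n i * x * eps n i := by
  have : ∀ i, eps n i * x * eps n i = x * eps n i := fun i => by
    rw [hx, mul_assoc, eps_self]
  simp only [this]
  rw [← Finset.mul_sum, sum_eps, mul_one]

lemma al_x {n : ℕ} (x : PiT n) (hx : ∀ y, y * x = x * y) (i : ℕ) :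
    al n i * (eps n i * x * eps n i) = eps n (i+1) * x * eps n (i+1) * al n i := by
  rw [hx (eps n i), hx (eps n (i+1)), mul_assoc x, mul_assoc x, eps_self, eps_self, mul_assoc,
    eps_al, ← hx (eps n i), ← mul_assoc, al_eps, hx]

lemma even_case {n : ℕ} (hn : 1 ≤ n) {k : ℕ} {x : PiT n} (hx : ∀ y, y * x = x * y)
    (hd : x ∈ NN n (2*k)) : ∃ c : ℂ, x = c • uu n ^ k := by
  choose c hc using fun i => even_diag hn (i := i) hd
  have step : ∀ i, k ≤ i → i + 1 < n → c i = c (i+1) := by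
    intro i hk hi
    have h := al_x x hx i
    rw [← hc, ← hc, mul_smul_comm, smul_mul_assoc, mul_assoc (uu n ^ k), eps_al, ← mul_assoc,
      upow_comm hn, mul_assoc, al_eps] at h
    exact smul_left_injective ℂ (upow_al_ne hn hi hk) h
  have all : ∀ m, k + m < n → c (k+m) = c k := by
    intro m
    induction m with
    | zero => intro _; rfl
    | succ m ih =>
      intro h
      rw [← ih (by omega), ← add_assoc, ← step (k+m) (by omega) (by omega)]
  refine ⟨c k, ?_⟩
  rw [central_sum x hx]
  have : uu n ^ k = ∑ j ∈ Finset.range n, uu n ^ k * eps n j := by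
    rw [← Finset.mul_sum, sum_eps, mul_one]
  rw [this, Finset.smul_sum]
  refine Finset.sum_congr rfl fun j hj => ?_
  rw [Finset.mem_range] at hj
  rw [← hc]
  by_cases hjk : j < k
  · rw [upow_eps_lt hn hjk, smul_zero, smul_zero]
  · obtain ⟨m, rfl⟩ := Nat.exists_eq_add_of_le (not_lt.mp hjk)
    rw [all m hj]

lemma odd_case {n : ℕ} (hn : 1 ≤ n) {k : ℕ} (hk : k + 1 < n) {x : PiT n}
    (hx : ∀ y, y * x = x * y) (hd : x ∈ NN n (2*k+1)) : x = 0 := by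
  rw [central_sum x hx]
  refine Finset.sum_eq_zero fun i _ => ?_
  induction i with
  | zero =>
    rcases odd_diag hn (i := 0) hd with ⟨k', l, h1, h2, _⟩ | ⟨_, h⟩
    · omega
    · exact h
  | succ i ih =>
    rcases odd_diag hn (i := i+1) hd with ⟨k', l, h1, h2, c, hc⟩ | ⟨_, h⟩
    · by_cases hi : i < n
      · have h := al_x x hx i
        rw [ih (Finset.mem_range.mpr hi), mul_zero, ← hc, smul_mul_assoc, eq_comm,
          smul_eq_zero] at h
        rcases h with h | h
        · rw [← hc, h, zero_smul]
        · exact absurd h (loop_ne hn h1 (by omega))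
      · omega
    · exact h

end

end TPre

/-- **Theorem (the center of `A` below the top degree).**
For `A = Π_{T_n}` with top degree `h - 2 = 2n - 1`:
each `z_{2k} = ∑_{i=k+1}^{n} c_{i,2k}` (for `0 ≤ 2k ≤ h-3`) is central, and for every
degree `d` below the top degree, every central element of degree `d` is a scalar multiple
of `z_d` if `d` is even, and is `0` if `d` is odd.  In particular, the non-top-degree part
of the center `Z = HH^0(A)` is concentrated in even degrees, with one dimension in each
even degree `2k`, `0 ≤ 2k ≤ h-3`. -/
theorem center_below_top_degree (n : ℕ) (hn : 1 ≤ n) :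
    (∀ k : ℕ, 2 * k ≤ 2 * n - 2 → zz n k ∈ Subalgebra.center ℂ (PiT n)) ∧
    (∀ d : ℕ, d < 2 * n - 1 →
      ∀ x ∈ (Subalgebra.center ℂ (PiT n)).toSubmodule ⊓ adeg n d,
        (Even d → ∃ c : ℂ, x = c • zz n (d / 2)) ∧ (Odd d → x = 0)) := by
  refine ⟨fun k _ => ?_, fun d hd x hx => ?_⟩
  · rw [Subalgebra.mem_center_iff, zz_eq hn]
    exact fun y => upow_comm hn k y
  · obtain ⟨hc, hx⟩ := Submodule.mem_inf.mp hx
    have hc' : ∀ y, y * x = x * y := (Subalgebra.mem_center_iff (R := ℂ)).mp hc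
    have hN := adeg_le hn d hx
    constructor
    · rintro ⟨k, rfl⟩
      rw [← two_mul] at hN
      obtain ⟨c, h⟩ := even_case hn hc' hN
      refine ⟨c, ?_⟩
      rw [zz_eq hn, h, show (k + k) / 2 = k by omega]
    · rintro ⟨k, rfl⟩
      exact odd_case hn (by omega) hc' hN
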